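/- The number of 321-avoiding permutations of {1,...,N} with exactly k left-to-right maxima equals the number of 312-avoiding permutations of {1,...,N} with exactly k left-to-right maxima, and both equal the Narayana number (1/k)*binomial(N-1,k-1)*binomial(N,k-1). -/

import Mathlib

open Finset

/-- The number of left-to-right maxima of a permutation. -/
def lrmCount {N : ℕ} (π : Equiv.Perm (Fin N)) : ℕ :=
  (Finset.univ.filter (fun j : Fin N => ∀ i, i < j → π i < π j)).card

/-- 321-avoidance. -/
def Avoids321 {N : ℕ} (π : Equiv.Perm (Fin N)) : Prop :=
  ∀ i j k : Fin N, i < j → j < k → ¬(π k < π j ∧ π j < π i)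

instance {N : ℕ} : DecidablePred (@Avoids321 N) := fun π => by
  unfold Avoids321; infer_instance

/-- 312-avoidance. -/
def Avoids312 {N : ℕ} (π : Equiv.Perm (Fin N)) : Prop :=
  ∀ i j k : Fin N, i < j → j < k → ¬(π j < π k ∧ π k < π i)

instance {N : ℕ} : DecidablePred (@Avoids312 N) := fun π => by
  unfold Avoids312; infer_instance

/-- Number of strict records of a sequence. -/
def recs {n : ℕ} (M : Fin n → ℕ) : ℕ :=
  (Finset.univ.filter (fun j : Fin n => ∀ i, i < j → M i < M j)).card

/-- Admissible running-maximum sequences of length n+1, last value m, k records. -/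
def Bf : (n : ℕ) → ℕ → ℕ → Finset (Fin (n+1) → ℕ)
  | 0, m, k => if k = 1 then {fun _ => m} else ∅
  | n+1, m, k => if n + 1 ≤ m ∧ 1 ≤ k then
      (Bf n m k ∪ (Finset.range m).biUnion (fun m' => Bf n m' (k-1))).image
        (fun p => (Fin.snoc p m : Fin (n+2) → ℕ)) else ∅

lemma recs_snoc {n : ℕ} (p : Fin (n+1) → ℕ) (hp : Monotone p) (m : ℕ) :
    recs (Fin.snoc p m : Fin (n+2) → ℕ) = recs p + if p (Fin.last n) < m then 1 else 0 := by
  unfold recs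
  rw [Finset.card_filter, Finset.card_filter, Fin.sum_univ_castSucc]
  congr 1
  · apply Finset.sum_congr rfl
    intro j _
    congr 1
    apply propext
    constructor
    · intro h i hi
      have := h i.castSucc (by simpa using hi)
      simpa using this
    · intro h i
      induction i using Fin.lastCases with
      | last => intro hi; exact absurd hi (not_lt.mpr (Fin.le_last _))
      | cast i => intro hi; simpa using h i (by simpa using hi)
  · congr 1
    apply propext
    constructor
    · intro h
      simpa using h (Fin.last n).castSucc (Fin.castSucc_lt_last _)
    · intro h i
      induction i using Fin.lastCases with
      | last => intro hi; exact absurd hi (lt_irrefl _)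
      | cast i =>
        intro _
        simpa using lt_of_le_of_lt (hp (Fin.le_last i)) h

lemma mono_snoc {n : ℕ} (p : Fin (n+1) → ℕ) (m : ℕ) :
    Monotone (Fin.snoc p m : Fin (n+2) → ℕ) ↔ Monotone p ∧ p (Fin.last n) ≤ m := by
  constructor
  · intro h
    constructor
    · intro i j hij
      simpa using h (Fin.castSucc_le_castSucc_iff.mpr hij)
    · simpa using h (Fin.le_last (Fin.last n).castSucc)
  · rintro ⟨hp, hl⟩ i j hij
    induction j using Fin.lastCases with
    | last =>
      induction i using Fin.lastCases with
      | last => exact le_rfl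
      | cast i => simpa using (hp (Fin.le_last i)).trans hl
    | cast j =>
      induction i using Fin.lastCases with
      | last => exact absurd hij (not_le.mpr (Fin.castSucc_lt_last _))
      | cast i => simpa using hp (Fin.castSucc_le_castSucc_iff.mp hij)

lemma mem_Bf (n : ℕ) : ∀ (m k : ℕ) (M : Fin (n+1) → ℕ), M ∈ Bf n m k ↔
    Monotone M ∧ (∀ j : Fin (n+1), (j : ℕ) ≤ M j) ∧ M (Fin.last n) = m ∧ recs M = k := by
  induction n with
  | zero =>
    intro m k M
    have h1 : recs M = 1 := by
      unfold recs
      rw [Finset.filter_true_of_mem]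
      · simp
      · intro x _ i hi
        omega
    have h2 : Monotone M := by
      intro i j _
      rw [show i = j by omega]
    have h3 : M = (fun _ => m) ↔ M (Fin.last 0) = m := by
      constructor
      · intro h; rw [h]
      · intro h; funext i; rw [← h, show i = Fin.last 0 by omega]
    have h4 : ∀ j : Fin 1, (j : ℕ) ≤ M j := by intro j; omega
    unfold Bf
    split_ifs with hk
    · simp only [Finset.mem_singleton, h3, h1, hk]
      tauto
    · simp only [Finset.notMem_empty, h1, false_iff]
      rintro ⟨-, -, -, h⟩
      exact hk h.symm
  | succ n ih =>
    intro m k M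
    induction M using Fin.snocCases with
    | _ p x =>
    have hpos : (∀ j : Fin (n+2), (j : ℕ) ≤ (Fin.snoc p x : Fin (n+2) → ℕ) j) ↔
        (∀ j : Fin (n+1), (j : ℕ) ≤ p j) ∧ n + 1 ≤ x := by
      constructor
      · intro h
        refine ⟨fun j => by simpa using h j.castSucc, by simpa using h (Fin.last _)⟩
      · rintro ⟨h1, h2⟩ j
        induction j using Fin.lastCases with
        | last => simpa using h2
        | cast j => simpa using h1 j
    rw [hpos, mono_snoc, Fin.snoc_last]
    unfold Bf
    split_ifs with hk
    · simp only [Finset.mem_image, Finset.mem_union, Finset.mem_biUnion, Finset.mem_range, ih]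
      constructor
      · rintro ⟨q, hq, he⟩
        obtain ⟨rfl, rfl⟩ := Fin.snoc_inj.mp he
        rcases hq with ⟨h1, h2, h3, h4⟩ | ⟨m', hm', h1, h2, h3, h4⟩
        · refine ⟨⟨h1, h3.le⟩, ⟨h2, hk.1⟩, rfl, ?_⟩
          rw [recs_snoc _ h1, if_neg (by omega)]; omega
        · refine ⟨⟨h1, by omega⟩, ⟨h2, hk.1⟩, rfl, ?_⟩
          rw [recs_snoc _ h1, if_pos (by omega)]; omega
      · rintro ⟨⟨h1, h3⟩, ⟨h2, h4⟩, rfl, h5⟩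
        rw [recs_snoc _ h1] at h5
        refine ⟨p, ?_, rfl⟩
        split_ifs at h5 with h6
        · right
          exact ⟨_, h6, h1, h2, rfl, by omega⟩
        · left
          exact ⟨h1, h2, by omega, by omega⟩
    · simp only [Finset.notMem_empty, false_iff]
      rintro ⟨⟨h1, h3⟩, ⟨h2, h4⟩, rfl, h5⟩
      apply hk
      refine ⟨h4, ?_⟩
      rw [← h5]
      unfold recs
      rw [Nat.one_le_iff_ne_zero, ← Nat.pos_iff_ne_zero, Finset.card_pos]
      exact ⟨0, by simp⟩

lemma card_Bf_succ (n m k : ℕ) (h : n + 1 ≤ m) : (Bf (n+1) m (k+1)).card =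
    (Bf n m (k+1)).card + ∑ m' ∈ Finset.range m, (Bf n m' k).card := by
  conv_lhs => unfold Bf
  rw [if_pos ⟨h, by omega⟩, Finset.card_image_of_injective, Finset.card_union_of_disjoint,
    Finset.card_biUnion]
  · rfl
  · intro a _ b _ hab
    show Disjoint _ _
    rw [Finset.disjoint_left]
    intro M h1 h2
    rw [mem_Bf] at h1 h2
    exact hab (h1.2.2.1.symm.trans h2.2.2.1)
  · rw [Finset.disjoint_left]
    intro M h1 h2
    simp only [Finset.mem_biUnion, Finset.mem_range, mem_Bf] at h1 h2
    obtain ⟨a, h2, h3⟩ := h2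
    omega
  · intro p q hpq
    exact (Fin.snoc_inj.mp hpq).1

lemma Bf_empty (n m k : ℕ) (h : m < n) : Bf n m k = ∅ := by
  rw [Finset.eq_empty_iff_forall_notMem]
  intro M hM
  rw [mem_Bf] at hM
  have := hM.2.1 (Fin.last n)
  rw [hM.2.2.1] at this
  simp at this
  omega

lemma Bf_k_zero (n m : ℕ) : Bf n m 0 = ∅ := by
  cases n <;> simp [Bf]

lemma sum_Bf (n : ℕ) : ∀ (k m : ℕ), n ≤ m →
    ((∑ m' ∈ Finset.range m, (Bf n m' (k+1)).card : ℕ) : ℤ) =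
      n.choose k * m.choose (k+1) - n.choose (k+1) * m.choose k := by
  induction n with
  | zero =>
    intro k m _
    rcases k with _ | k
    · simp [Bf]
    · simp [Bf]
  | succ n ih =>
    intro k m hm
    induction m, hm using Nat.le_induction with
    | base =>
      rw [Finset.sum_eq_zero]
      · push_cast; ring
      · intro x hx
        rw [Bf_empty _ _ _ (Finset.mem_range.mp hx)]; rfl
    | succ m hm ih2 =>
      rw [Finset.sum_range_succ, Nat.cast_add, ih2, card_Bf_succ _ _ _ hm]
      have e1 := ih k m (by omega)
      have e2 := ih k (m+1) (by omega)
      rw [Finset.sum_range_succ, Nat.cast_add, e1] at e2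
      rw [Nat.cast_add]
      rcases k with _ | k
      · simp only [Bf_k_zero]
        simp at e2 ⊢
        linarith
      · rw [ih k m (by omega)]
        simp only [Nat.choose_succ_succ, Nat.cast_add] at e2 ⊢
        linarith

lemma card_Bf_final (n k : ℕ) : ((Bf n n (k+1)).card : ℚ) =
    (1 / ((k+1 : ℕ) : ℚ)) * (n.choose k) * ((n+1).choose k) := by
  have h1 := sum_Bf n k (n+1) (by omega)
  have h2 := sum_Bf n k n le_rfl
  rw [Finset.sum_range_succ, Nat.cast_add, h2] at h1
  have h3 : ((Bf n n (k+1)).card : ℚ) =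
    n.choose k * (n+1).choose (k+1) - n.choose (k+1) * (n+1).choose k := by
    have : ((Bf n n (k+1)).card : ℤ) =
      n.choose k * (n+1).choose (k+1) - n.choose (k+1) * (n+1).choose k := by linarith
    exact_mod_cast this
  rw [h3]
  have hk : ((k+1 : ℕ) : ℚ) ≠ 0 := by positivity
  rcases le_or_gt k n with hkn | hkn
  · have a1 := Nat.choose_succ_right_eq (n+1) k
    have a2 := Nat.choose_succ_right_eq n k
    have a1' : ((n+1).choose (k+1) : ℚ) * (k+1) = (n+1).choose k * ((n:ℚ)+1-k) := by
      have : (((n+1-k : ℕ)) : ℚ) = (n:ℚ)+1-k := by push_cast [Nat.cast_sub (show k ≤ n+1 by omega)]; ring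
      rw [← this]; exact_mod_cast a1
    have a2' : (n.choose (k+1) : ℚ) * (k+1) = n.choose k * ((n:ℚ)-k) := by
      have : (((n-k : ℕ)) : ℚ) = (n:ℚ)-k := by push_cast [Nat.cast_sub hkn]; ring
      rw [← this]; exact_mod_cast a2
    rw [one_div, mul_assoc, eq_inv_mul_iff_mul_eq₀ hk]
    push_cast
    linear_combination (n.choose k : ℚ) * a1' - ((n+1).choose k : ℚ) * a2'
  · rw [Nat.choose_eq_zero_of_lt hkn, Nat.choose_eq_zero_of_lt (show n < k+1 by omega)]
    simp

/-- Running maximum of a permutation. -/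
def runMax {N : ℕ} (π : Equiv.Perm (Fin N)) (j : Fin N) : ℕ :=
  (Finset.Iic j).sup (fun i => (π i : ℕ))

lemma le_runMax {N : ℕ} (π : Equiv.Perm (Fin N)) {i j : Fin N} (h : i ≤ j) :
    (π i : ℕ) ≤ runMax π j :=
  Finset.le_sup (f := fun i => (π i : ℕ)) (Finset.mem_Iic.mpr h)

lemma exists_runMax {N : ℕ} (π : Equiv.Perm (Fin N)) (j : Fin N) :
    ∃ i, i ≤ j ∧ runMax π j = π i := by
  obtain ⟨i, hi, h⟩ := Finset.exists_mem_eq_sup (Finset.Iic j) ⟨j, by simp⟩ (fun i => (π i : ℕ))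
  exact ⟨i, Finset.mem_Iic.mp hi, h⟩

lemma runMax_mono {N : ℕ} (π : Equiv.Perm (Fin N)) : Monotone (runMax π) := by
  intro i j hij
  obtain ⟨a, ha, h⟩ := exists_runMax π i
  rw [h]
  exact le_runMax π (ha.trans hij)

lemma self_le_runMax {N : ℕ} (π : Equiv.Perm (Fin N)) (j : Fin N) : (j : ℕ) ≤ runMax π j := by
  have h : ((Finset.Iic j).image (fun i => (π i : ℕ))).card ≤ (Finset.range (runMax π j + 1)).card := by
    apply Finset.card_le_card
    intro x hx
    obtain ⟨i, hi, rfl⟩ := Finset.mem_image.mp hx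
    have := le_runMax π (Finset.mem_Iic.mp hi)
    simp; omega
  rw [Finset.card_image_of_injective (f := fun i => (π i : ℕ)) _ (Fin.val_injective.comp π.injective)] at h
  simp at h
  omega

lemma lrm_iff {N : ℕ} (π : Equiv.Perm (Fin N)) (j : Fin N) :
    (∀ i, i < j → π i < π j) ↔ ∀ i, i < j → runMax π i < runMax π j := by
  constructor
  · intro h i hi
    obtain ⟨a, ha, e⟩ := exists_runMax π i
    rw [e]
    exact lt_of_lt_of_le (Fin.lt_def.mp (h a (lt_of_le_of_lt ha hi))) (le_runMax π le_rfl)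
  · intro h i hi
    obtain ⟨a, ha, e⟩ := exists_runMax π j
    rcases ha.lt_or_eq with ha | rfl
    · have h1 := h a ha
      have h2 := le_runMax π (le_refl a)
      omega
    · have h1 := h i hi
      have h2 := le_runMax π (le_refl i)
      rw [Fin.lt_def]
      omega

lemma lrmCount_eq {N : ℕ} (π : Equiv.Perm (Fin N)) : lrmCount π = recs (runMax π) := by
  unfold lrmCount recs
  congr 1
  ext j
  simp only [Finset.mem_filter, Finset.mem_univ, true_and]
  exact lrm_iff π j

lemma lrm_val {N : ℕ} (π : Equiv.Perm (Fin N)) (j : Fin N) (h : ∀ i, i < j → π i < π j) :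
    (π j : ℕ) = runMax π j := by
  obtain ⟨a, ha, e⟩ := exists_runMax π j
  rcases ha.lt_or_eq with ha | rfl
  · have h1 := h a ha
    have h2 := le_runMax π (le_refl j)
    rw [Fin.lt_def] at h1
    omega
  · exact e.symm

lemma inj_of_step {N : ℕ} (P : Equiv.Perm (Fin N) → Prop)
    (step : ∀ π σ, P π → P σ → runMax π = runMax σ → ∀ j, (∀ i, i < j → π i = σ i) →
      (∃ i, i < j ∧ π j < π i) → (∃ i, i < j ∧ σ j < σ i) → ¬ π j < σ j)
    (π σ : Equiv.Perm (Fin N)) (hπ : P π) (hσ : P σ) (h : runMax π = runMax σ) : π = σ := by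
  have key : ∀ j, π j = σ j := by
    intro j
    induction j using WellFoundedLT.induction with
    | ind j ih =>
    have hiff := lrm_iff π j
    rw [h, ← lrm_iff σ j] at hiff
    by_cases hr : ∀ i, i < j → π i < π j
    · apply Fin.ext
      rw [lrm_val π j hr, lrm_val σ j (hiff.mp hr), h]
    · have hr2 := fun q => hr (hiff.mpr q)
      have conv : ∀ τ : Equiv.Perm (Fin N), (¬ ∀ i, i < j → τ i < τ j) → ∃ i, i < j ∧ τ j < τ i := by
        intro τ ht
        push Not at ht
        obtain ⟨i, hi, hle⟩ := ht
        exact ⟨i, hi, lt_of_le_of_ne hle (fun e => hi.ne' (τ.injective e))⟩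
      have a := conv π hr
      have b := conv σ hr2
      have c1 := step π σ hπ hσ h j ih a b
      have c2 := step σ π hσ hπ h.symm j (fun i hi => (ih i hi).symm) b a
      exact le_antisymm (not_lt.mp c2) (not_lt.mp c1)
  exact Equiv.ext key

lemma later {N : ℕ} (π σ : Equiv.Perm (Fin N)) (j : Fin N) (h : ∀ i, i < j → π i = σ i)
    (hne : π j ≠ σ j) : ∃ l, j < l ∧ σ l = π j := by
  refine ⟨σ.symm (π j), ?_, by simp⟩
  by_contra hc
  rcases (not_lt.mp hc).lt_or_eq with h1 | h1
  · have := h _ h1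
    rw [Equiv.apply_symm_apply] at this
    exact h1.ne (π.injective this)
  · apply hne
    rw [← Equiv.symm_apply_eq]
    exact h1

lemma inj321 {N : ℕ} (π σ : Equiv.Perm (Fin N)) (hπ : Avoids321 π) (hσ : Avoids321 σ)
    (h : runMax π = runMax σ) : π = σ := by
  refine inj_of_step Avoids321 ?_ π σ hπ hσ h
  rintro π σ hπ hσ - j hj - ⟨i, hi, hlt⟩ hl
  obtain ⟨l, hjl, e⟩ := later π σ j hj hl.ne
  exact hσ i j l hi hjl ⟨by rw [e]; exact hl, hlt⟩

lemma inj312 {N : ℕ} (π σ : Equiv.Perm (Fin N)) (hπ : Avoids312 π) (hσ : Avoids312 σ)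
    (h : runMax π = runMax σ) : π = σ := by
  refine inj_of_step Avoids312 ?_ π σ hπ hσ h
  rintro π σ hπ hσ - j hj - ⟨i, hi, hlt⟩ hl
  obtain ⟨l, hjl, e⟩ := later σ π j (fun i hi => (hj i hi).symm) hl.ne'
  refine hπ i j l hi hjl ⟨by rw [e]; exact hl, ?_⟩
  rw [e, hj i hi]; exact hlt

/-- Greedy choice at step j with used set U. -/
noncomputable def greedyStep (M : ℕ → ℕ) (c : Finset ℕ → ℕ) (j : ℕ) (U : Finset ℕ) : ℕ :=
  if ∀ i < j, M i < M j then M j else c (Finset.range (M j + 1) \ U)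

/-- Values used before step j. -/
noncomputable def greedyUsed (M : ℕ → ℕ) (c : Finset ℕ → ℕ) : ℕ → Finset ℕ
  | 0 => ∅
  | j+1 => insert (greedyStep M c j (greedyUsed M c j)) (greedyUsed M c j)

lemma greedy (M : ℕ → ℕ) (hM : Monotone M) (hj : ∀ j, j ≤ M j) (c : Finset ℕ → ℕ)
    (hc : ∀ s : Finset ℕ, s.Nonempty → c s ∈ s) :
    ∃ f : ℕ → ℕ, (∀ i j, i < j → f i ≠ f j) ∧ (∀ j, f j ≤ M j) ∧
      (∀ j, (∀ i < j, M i < M j) → f j = M j) ∧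
      (∀ j, (¬ ∀ i < j, M i < M j) →
        f j = c (Finset.range (M j + 1) \ (Finset.range j).image f)) := by
  let f : ℕ → ℕ := fun j => greedyStep M c j (greedyUsed M c j)
  have hU : ∀ j, greedyUsed M c j = (Finset.range j).image f := by
    intro j
    induction j with
    | zero => rfl
    | succ j ih =>
      rw [Finset.range_add_one, Finset.image_insert, ← ih]
      rfl
  have h1 : ∀ j, (∀ i < j, M i < M j) → f j = M j := by
    intro j h
    simp only [f, greedyStep]
    rw [if_pos h]
  have h2 : ∀ j, (¬ ∀ i < j, M i < M j) →
        f j = c (Finset.range (M j + 1) \ (Finset.range j).image f) := by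
    intro j h
    rw [← hU]
    simp only [f, greedyStep]
    rw [if_neg h]
  have h3 : ∀ j, (¬ ∀ i < j, M i < M j) →
      f j ∈ Finset.range (M j + 1) \ (Finset.range j).image f := by
    intro j h
    rw [h2 j h]
    apply hc
    rw [← Finset.card_pos]
    have a := Finset.le_card_sdiff ((Finset.range j).image f) (Finset.range (M j + 1))
    have b : ((Finset.range j).image f).card ≤ j := by
      simpa using (Finset.card_image_le (s := Finset.range j) (f := f))
    rw [Finset.card_range] at a
    have := hj j
    omega
  have h4 : ∀ j, f j ≤ M j := by
    intro j
    by_cases h : ∀ i < j, M i < M j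
    · exact (h1 j h).le
    · have := (Finset.mem_sdiff.mp (h3 j h)).1
      rw [Finset.mem_range] at this
      omega
  refine ⟨f, ?_, h4, h1, h2⟩
  intro i j hij e
  by_cases h : ∀ i < j, M i < M j
  · have a := h i hij
    have b := h4 i
    have d := h1 j h
    omega
  · apply (Finset.mem_sdiff.mp (h3 j h)).2
    rw [← e]
    exact Finset.mem_image_of_mem f (Finset.mem_range.mpr hij)

lemma surj_gen {n : ℕ} (M : Fin (n+1) → ℕ) (hM : Monotone M) (hj : ∀ j : Fin (n+1), (j : ℕ) ≤ M j)
    (hl : M (Fin.last n) = n) (c : Finset ℕ → ℕ) (hc : ∀ s : Finset ℕ, s.Nonempty → c s ∈ s) :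
    ∃ π : Equiv.Perm (Fin (n+1)), runMax π = M ∧
      ∀ i j l : Fin (n+1), i < j → j < l → π j < π i → π l < π i →
        ∃ s : Finset ℕ, (π j : ℕ) = c s ∧ (π l : ℕ) ∈ s := by
  let M' : ℕ → ℕ := fun j => if h : j < n + 1 then M ⟨j, h⟩ else j
  have e : ∀ j : Fin (n+1), M' j = M j := by
    intro j
    exact dif_pos j.isLt
  have hMn : ∀ j : Fin (n+1), M j ≤ n := fun j => hl ▸ hM (Fin.le_last j)
  have hM' : Monotone M' := by
    intro a b hab
    simp only [M']
    split_ifs with h1 h2 h2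
    · exact hM hab
    · have := hMn ⟨a, h1⟩
      omega
    · omega
    · exact hab
  have hj' : ∀ j, j ≤ M' j := by
    intro j
    simp only [M']
    split_ifs with h
    · exact hj ⟨j, h⟩
    · exact le_rfl
  obtain ⟨f, f1, f2, f3, f4⟩ := greedy M' hM' hj' c hc
  have flt : ∀ j : Fin (n+1), f j < n + 1 := by
    intro j
    have a := f2 j
    rw [e] at a
    have := hMn j
    omega
  let g : Fin (n+1) → Fin (n+1) := fun j => ⟨f j, flt j⟩
  have ginj : Function.Injective g := by
    intro a b hab
    have hab' : f a = f b := congrArg Fin.val hab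
    rcases lt_trichotomy a b with h | h | h
    · exact absurd hab' (f1 _ _ h)
    · exact h
    · exact absurd hab'.symm (f1 _ _ h)
  let π : Equiv.Perm (Fin (n+1)) := Equiv.ofBijective g (Finite.injective_iff_bijective.mp ginj)
  have hπ : ∀ j, (π j : ℕ) = f j := fun j => rfl
  refine ⟨π, ?_, ?_⟩
  · funext j
    apply le_antisymm
    · obtain ⟨i, hi, h⟩ := exists_runMax π j
      rw [h, hπ]
      exact (f2 i).trans ((e i).le.trans (hM hi))
    · have hex : ∃ i, M' i = M' j := ⟨j, rfl⟩
      have hs := Nat.find_spec hex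
      have hle : Nat.find hex ≤ j := Nat.find_min' hex rfl
      have hmin : ∀ i < Nat.find hex, M' i < M' (Nat.find hex) := by
        intro i hi
        apply lt_of_le_of_ne (hM' hi.le)
        rw [hs]
        exact Nat.find_min hex hi
      have h3 := f3 _ hmin
      have := le_runMax π (i := ⟨Nat.find hex, by omega⟩) (j := j) hle
      rw [hπ] at this
      change f (Nat.find hex) ≤ _ at this
      rw [h3, hs, e] at this
      exact this
  · intro i j l hij hjl h1 h2
    rw [Fin.lt_def, hπ, hπ] at h1 h2
    have a := f2 i
    have b : M' i ≤ M' j := hM' hij.le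
    have hn : ¬ ∀ i < (j : ℕ), M' i < M' j := by
      intro h
      have := f3 j h
      omega
    refine ⟨_, f4 j hn, ?_⟩
    rw [hπ, Finset.mem_sdiff, Finset.mem_range, Finset.mem_image]
    refine ⟨by omega, ?_⟩
    rintro ⟨x, hx, hxl⟩
    rw [Finset.mem_range] at hx
    exact f1 x l (by rw [Fin.lt_def] at hjl; omega) hxl

lemma surj321 {n : ℕ} (M : Fin (n+1) → ℕ) (hM : Monotone M) (hj : ∀ j : Fin (n+1), (j : ℕ) ≤ M j)
    (hl : M (Fin.last n) = n) : ∃ π, Avoids321 π ∧ runMax π = M := by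
  obtain ⟨π, h1, h2⟩ := surj_gen M hM hj hl (fun s => sInf (s : Set ℕ))
    (fun s hs => Nat.sInf_mem (s := (s : Set ℕ)) hs)
  refine ⟨π, ?_, h1⟩
  rintro i j l hij hjl ⟨a, b⟩
  obtain ⟨s, e, hs⟩ := h2 i j l hij hjl b (a.trans b)
  have : sInf (s : Set ℕ) ≤ π l := Nat.sInf_le hs
  rw [Fin.lt_def] at a
  omega

lemma surj312 {n : ℕ} (M : Fin (n+1) → ℕ) (hM : Monotone M) (hj : ∀ j : Fin (n+1), (j : ℕ) ≤ M j)
    (hl : M (Fin.last n) = n) : ∃ π, Avoids312 π ∧ runMax π = M := by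
  obtain ⟨π, h1, h2⟩ := surj_gen M hM hj hl (fun s => s.sup id) (by
    intro s hs
    obtain ⟨i, hi, h⟩ := Finset.exists_mem_eq_sup s hs id
    simp only [h]
    exact hi)
  refine ⟨π, ?_, h1⟩
  rintro i j l hij hjl ⟨a, b⟩
  obtain ⟨s, e, hs⟩ := h2 i j l hij hjl (a.trans b) b
  have : (π l : ℕ) ≤ s.sup id := Finset.le_sup (f := id) hs
  rw [Fin.lt_def] at a
  omega

lemma card_gen {n k : ℕ} (P : Equiv.Perm (Fin (n+1)) → Prop) [DecidablePred P]
    (inj : ∀ π σ, P π → P σ → runMax π = runMax σ → π = σ)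
    (surj : ∀ M : Fin (n+1) → ℕ, Monotone M → (∀ j : Fin (n+1), (j : ℕ) ≤ M j) → M (Fin.last n) = n →
      ∃ π, P π ∧ runMax π = M) :
    (Finset.univ.filter (fun π => P π ∧ lrmCount π = k)).card = (Bf n n k).card := by
  apply Finset.card_bij (fun π _ => runMax π)
  · intro π h
    rw [Finset.mem_filter] at h
    rw [mem_Bf]
    refine ⟨runMax_mono π, self_le_runMax π, ?_, ?_⟩
    · have a := self_le_runMax π (Fin.last n)
      obtain ⟨i, -, e⟩ := exists_runMax π (Fin.last n)
      rw [Fin.val_last] at a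
      omega
    · rw [← lrmCount_eq]; exact h.2.2
  · intro π h1 σ h2 e
    rw [Finset.mem_filter] at h1 h2
    exact inj π σ h1.2.1 h2.2.1 e
  · intro M hM
    rw [mem_Bf] at hM
    obtain ⟨π, h1, h2⟩ := surj M hM.1 hM.2.1 hM.2.2.1
    refine ⟨π, ?_, h2⟩
    rw [Finset.mem_filter, lrmCount_eq, h2]
    exact ⟨Finset.mem_univ _, h1, hM.2.2.2⟩

theorem stmt12 (N k : ℕ) (hk : 1 ≤ k) (hkN : k ≤ N) :
    (Finset.univ.filter (fun π : Equiv.Perm (Fin N) =>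
        Avoids321 π ∧ lrmCount π = k)).card
      = (Finset.univ.filter (fun π : Equiv.Perm (Fin N) =>
        Avoids312 π ∧ lrmCount π = k)).card ∧
    ((Finset.univ.filter (fun π : Equiv.Perm (Fin N) =>
        Avoids321 π ∧ lrmCount π = k)).card : ℚ)
      = (1 / k) * ((N - 1).choose (k - 1)) * (N.choose (k - 1)) := by
  obtain ⟨n, rfl⟩ : ∃ n, N = n + 1 := ⟨N - 1, by omega⟩
  obtain ⟨k, rfl⟩ : ∃ k', k = k' + 1 := ⟨k - 1, by omega⟩
  have e1 := card_gen (n := n) (k := k + 1) Avoids321 inj321 surj321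
  have e2 := card_gen (n := n) (k := k + 1) Avoids312 inj312 surj312
  refine ⟨e1.trans e2.symm, ?_⟩
  rw [e1, card_Bf_final]
  rfl
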